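/- arXiv:2511.22126 — 2 statements merged into one kernel-verified Lean document; each statement's English description precedes it below -/
import Mathlib

section
/- Let (X₀, X₁)_X be a pair of compatible metric spaces with X₀ ∩ X₁ ≠ ∅, let θ ∈ (0, 1) and q ∈ [1, ∞]. The functional β_{θ,q}(x, y) := Γ_{θ,q}((K_M(2^k; x, y))_{k∈ℤ}) is a metric on the set X₀ ∩ X₁. -/
open scoped ENNReal Classical

/-- A function `d` is a metric on the subset `A` of `X`. -/
structure IsMetricOn {X : Type*} (d : X → X → ℝ) (A : Set X) : Prop where
  refl : ∀ x ∈ A, d x x = 0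
  eq_of_dist_eq_zero : ∀ x ∈ A, ∀ y ∈ A, d x y = 0 → x = y
  symm : ∀ x ∈ A, ∀ y ∈ A, d x y = d y x
  triangle : ∀ x ∈ A, ∀ y ∈ A, ∀ z ∈ A, d x z ≤ d x y + d y z

/-- A pair of compatible metric spaces `(X₀, X₁)_X` inside an ambient metric space `X`. -/
structure CompatiblePair (X : Type*) [MetricSpace X] where
  X0 : Set X
  X1 : Set X
  d0 : X → X → ℝ
  d1 : X → X → ℝ
  inter_nonempty : (X0 ∩ X1).Nonempty
  met0 : IsMetricOn d0 X0
  met1 : IsMetricOn d1 X1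
  C0 : ℝ
  C1 : ℝ
  C0_pos : 0 < C0
  C1_pos : 0 < C1
  compat0 : ∀ x ∈ X0, ∀ y ∈ X0, dist x y ≤ C0 * d0 x y
  compat1 : ∀ x ∈ X1, ∀ y ∈ X1, dist x y ≤ C1 * d1 x y

namespace CompatiblePair

variable {X : Type*} [MetricSpace X] (P : CompatiblePair X)

/-- The `J_M` functional: `J_M(t; x, y) = max {d₀(x,y), t·d₁(x,y)}`. -/
noncomputable def JM (t : ℝ) (x y : X) : ℝ := max (P.d0 x y) (t * P.d1 x y)

/-- The cost function `h_t` on pairs in `X₀² ∪ X₁²`. -/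
noncomputable def hFun (t : ℝ) (x y : X) : ℝ :=
  if x ∈ P.X0 ∩ P.X1 ∧ y ∈ P.X0 ∩ P.X1 then min (P.d0 x y) (t * P.d1 x y)
  else if x ∈ P.X0 ∧ y ∈ P.X0 then P.d0 x y
  else t * P.d1 x y

/-- `f 0 = x, …, f n = y` is an admissible linking sequence from `x` to `y` in `X₀ ∪ X₁`. -/
def IsAdmissibleChain (x y : X) (n : ℕ) (f : ℕ → X) : Prop :=
  f 0 = x ∧ f n = y ∧ (∀ k ≤ n, f k ∈ P.X0 ∪ P.X1) ∧
    ∀ k < n, (f k ∈ P.X0 ∧ f (k + 1) ∈ P.X0) ∨ (f k ∈ P.X1 ∧ f (k + 1) ∈ P.X1)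

/-- The `K_M` functional: infimum of `∑ h_t` over admissible linking sequences. -/
noncomputable def KM (t : ℝ) (x y : X) : ℝ :=
  sInf { s : ℝ | ∃ n f, P.IsAdmissibleChain x y n f ∧
    s = ∑ k ∈ Finset.range n, P.hFun t (f k) (f (k + 1)) }

end CompatiblePair

/-- The functional `Γ_{θ,q}` of a bi-infinite real sequence, valued in `[0,∞]`. -/
noncomputable def GammaE (θ : ℝ) (q : ℝ≥0∞) (x : ℤ → ℝ) : ℝ≥0∞ :=
  if q = ∞ then ⨆ k : ℤ, ENNReal.ofReal ((2 : ℝ) ^ (-(k : ℝ) * θ) * |x k|)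
  else (∑' k : ℤ, ENNReal.ofReal ((2 : ℝ) ^ (-(k : ℝ) * θ) * |x k|) ^ q.toReal) ^ (1 / q.toReal)

/-- The real-valued functional `Γ_{θ,q}`. -/
noncomputable def Gamma (θ : ℝ) (q : ℝ≥0∞) (x : ℤ → ℝ) : ℝ := (GammaE θ q x).toReal

/-- The constant `M_{θ,q} = Γ_{θ,q}((min{1, 2^k})_k)`. -/
noncomputable def MThetaQ (θ : ℝ) (q : ℝ≥0∞) : ℝ :=
  Gamma θ q (fun k : ℤ => min 1 ((2 : ℝ) ^ k))

/-- The constant `M'_{θ,q} = (∑_j (2^{jθ} min{1,2^{-j}})^p)^{1/p}` (with `p` the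
conjugate exponent of `q`, and the supremum modification for `p = ∞`). -/
noncomputable def MConst' (θ : ℝ) (p : ℝ≥0∞) : ℝ :=
  (if p = ∞ then ⨆ j : ℤ, ENNReal.ofReal ((2 : ℝ) ^ ((j : ℝ) * θ) * min 1 ((2 : ℝ) ^ (-(j : ℝ))))
   else (∑' j : ℤ,
      ENNReal.ofReal ((2 : ℝ) ^ ((j : ℝ) * θ) * min 1 ((2 : ℝ) ^ (-(j : ℝ)))) ^ p.toReal) ^
        (1 / p.toReal)).toReal

/-- The `ℓ^q` norm of a bi-infinite real sequence, valued in `[0,∞]`. -/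
noncomputable def lqNorm (q : ℝ≥0∞) (c : ℤ → ℝ) : ℝ≥0∞ :=
  if q = ∞ then ⨆ k : ℤ, ENNReal.ofReal |c k|
  else (∑' k : ℤ, ENNReal.ofReal |c k| ^ q.toReal) ^ (1 / q.toReal)

namespace CompatiblePair

variable {X : Type*} [MetricSpace X] (P : CompatiblePair X)

/-- The metric `β_{θ,q}(x,y) = Γ_{θ,q}((K_M(2^k; x, y))_k)` on `X₀ ∩ X₁`. -/
noncomputable def beta (θ : ℝ) (q : ℝ≥0∞) (x y : X) : ℝ :=
  Gamma θ q (fun k : ℤ => P.KM ((2 : ℝ) ^ k) x y)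

/-- `u` is an approximating sequence of `x` in `(X₀ ∩ X₁, J_M(1))`: a sequence in
`X₀ ∩ X₁`, Cauchy for `J_M(1)`, with `K_M(1; uₙ, x) → 0`. -/
def IsApproxSeq (x : X) (u : ℕ → X) : Prop :=
  (∀ n, u n ∈ P.X0 ∩ P.X1) ∧
  (∀ ε > 0, ∃ N, ∀ m ≥ N, ∀ n ≥ N, P.JM 1 (u m) (u n) < ε) ∧
  Filter.Tendsto (fun n => P.KM 1 (u n) x) Filter.atTop (nhds 0)

/-- The bi-infinite linking sequence `S_k = u_k` for `k ≥ 0`, `S_k = v_{-k}` for `k < 0`. -/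
noncomputable def linkSeq (u v : ℕ → X) : ℤ → X :=
  fun k => if 0 ≤ k then u k.toNat else v (-k).toNat

/-- The functional `p_{θ,q}` valued in `[0,∞]`: infimum of
`Γ_{θ,q}((J_M(2^k; S_k, S_{k+1}))_k)` over approximating sequences of `x` and `y`. -/
noncomputable def pFunE (θ : ℝ) (q : ℝ≥0∞) (x y : X) : ℝ≥0∞ :=
  ⨅ (u : ℕ → X) (v : ℕ → X) (_ : P.IsApproxSeq x u) (_ : P.IsApproxSeq y v),
    GammaE θ q (fun k : ℤ =>
      P.JM ((2 : ℝ) ^ k) (linkSeq u v k) (linkSeq u v (k + 1)))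

/-- The real-valued functional `p_{θ,q}`. -/
noncomputable def pFun (θ : ℝ) (q : ℝ≥0∞) (x y : X) : ℝ := (P.pFunE θ q x y).toReal

/-- The symmetrization `P_{θ,q}(x,y) = (p_{θ,q}(x,y) + p_{θ,q}(y,x))/2`. -/
noncomputable def PFun (θ : ℝ) (q : ℝ≥0∞) (x y : X) : ℝ :=
  (P.pFun θ q x y + P.pFun θ q y x) / 2

/-- The metric `δ_{θ,q}`: infimum of `∑ P_{θ,q}` over finite chains in `X₀ ∩ X₁`. -/
noncomputable def delta (θ : ℝ) (q : ℝ≥0∞) (x y : X) : ℝ :=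
  sInf { s : ℝ | ∃ (n : ℕ) (f : ℕ → X), f 0 = x ∧ f n = y ∧
    (∀ k ≤ n, f k ∈ P.X0 ∩ P.X1) ∧
    s = ∑ j ∈ Finset.range n, P.PFun θ q (f j) (f (j + 1)) }

end CompatiblePair

namespace CompatiblePair

variable {X : Type*} [MetricSpace X] (P : CompatiblePair X)

/-- The pair `(x, y)` lies in `X₀² ∪ X₁²`. -/
def Linked (x y : X) : Prop := (x ∈ P.X0 ∧ y ∈ P.X0) ∨ (x ∈ P.X1 ∧ y ∈ P.X1)

/-- The total cost `∑ h_t(f k, f (k + 1))` of the first `n` steps of `f`. -/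
noncomputable def chainCost (t : ℝ) (n : ℕ) (f : ℕ → X) : ℝ :=
  ∑ k ∈ Finset.range n, P.hFun t (f k) (f (k + 1))

variable {P}

theorem Linked.symm {x y : X} (h : P.Linked x y) : P.Linked y x :=
  h.imp And.symm And.symm

theorem hFun_comm {x y : X} (t : ℝ) (h : P.Linked x y) : P.hFun t x y = P.hFun t y x := by
  have h0 : x ∈ P.X0 → y ∈ P.X0 → P.d0 x y = P.d0 y x := fun hx hy => P.met0.symm x hx y hy
  have h1 : x ∈ P.X1 → y ∈ P.X1 → P.d1 x y = P.d1 y x := fun hx hy => P.met1.symm x hx y hy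
  unfold hFun Linked at *
  simp only [Set.mem_inter_iff] at *
  grind

/-- On linked pairs `h_t` dominates a multiple of the ambient metric. -/
theorem mul_dist_le_hFun {t : ℝ} (ht : 0 < t) {x y : X} (h : P.Linked x y) :
    min P.C0⁻¹ (t * P.C1⁻¹) * dist x y ≤ P.hFun t x y := by
  have h0 : x ∈ P.X0 → y ∈ P.X0 → min P.C0⁻¹ (t * P.C1⁻¹) * dist x y ≤ P.d0 x y := by
    intro hx hy
    calc min P.C0⁻¹ (t * P.C1⁻¹) * dist x y ≤ P.C0⁻¹ * dist x y := by
          gcongr; exact min_le_left _ _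
      _ ≤ P.d0 x y := by
          rw [inv_mul_le_iff₀ P.C0_pos]
          exact P.compat0 x hx y hy
  have h1 : x ∈ P.X1 → y ∈ P.X1 → min P.C0⁻¹ (t * P.C1⁻¹) * dist x y ≤ t * P.d1 x y := by
    intro hx hy
    calc min P.C0⁻¹ (t * P.C1⁻¹) * dist x y ≤ t * P.C1⁻¹ * dist x y := by
          gcongr; exact min_le_right _ _
      _ = t * (P.C1⁻¹ * dist x y) := mul_assoc _ _ _
      _ ≤ t * P.d1 x y := by
          gcongr
          rw [inv_mul_le_iff₀ P.C1_pos]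
          exact P.compat1 x hx y hy
  unfold hFun
  unfold Linked at h
  split_ifs with hi hii
  · exact le_min (h0 hi.1.1 hi.2.1) (h1 hi.1.2 hi.2.2)
  · exact h0 hii.1 hii.2
  · have hX1 := h.resolve_left hii
    exact h1 hX1.1 hX1.2

variable (P) in
theorem min_inv_pos {t : ℝ} (ht : 0 < t) : 0 < min P.C0⁻¹ (t * P.C1⁻¹) :=
  lt_min (inv_pos.2 P.C0_pos) (mul_pos ht (inv_pos.2 P.C1_pos))

theorem mul_dist_le_chainCost {t : ℝ} (ht : 0 < t) {x y : X} {n : ℕ} {f : ℕ → X}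
    (h : P.IsAdmissibleChain x y n f) :
    min P.C0⁻¹ (t * P.C1⁻¹) * dist x y ≤ P.chainCost t n f := by
  obtain ⟨rfl, rfl, -, hlink⟩ := h
  calc min P.C0⁻¹ (t * P.C1⁻¹) * dist (f 0) (f n)
      ≤ min P.C0⁻¹ (t * P.C1⁻¹) * ∑ k ∈ Finset.range n, dist (f k) (f (k + 1)) :=
        mul_le_mul_of_nonneg_left (dist_le_range_sum_dist f n) (P.min_inv_pos ht).le
    _ ≤ P.chainCost t n f := by
        rw [Finset.mul_sum]
        exact Finset.sum_le_sum fun k hk => mul_dist_le_hFun ht (hlink k (Finset.mem_range.1 hk))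

theorem chainCost_nonneg {t : ℝ} (ht : 0 < t) {x y : X} {n : ℕ} {f : ℕ → X}
    (h : P.IsAdmissibleChain x y n f) : 0 ≤ P.chainCost t n f :=
  (mul_nonneg (P.min_inv_pos ht).le dist_nonneg).trans (mul_dist_le_chainCost ht h)

theorem IsAdmissibleChain.reverse {x y : X} {n : ℕ} {f : ℕ → X}
    (h : P.IsAdmissibleChain x y n f) : P.IsAdmissibleChain y x n (fun k => f (n - k)) := by
  obtain ⟨h0, hn, hmem, hlink⟩ := h
  refine ⟨by simpa using hn, by simpa using h0, fun k _ => hmem _ (Nat.sub_le _ _), fun k hk => ?_⟩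
  have := Linked.symm (hlink (n - (k + 1)) (by omega))
  rwa [show n - (k + 1) + 1 = n - k by omega] at this

theorem IsAdmissibleChain.chainCost_reverse (t : ℝ) {x y : X} {n : ℕ} {f : ℕ → X}
    (h : P.IsAdmissibleChain x y n f) :
    P.chainCost t n (fun k => f (n - k)) = P.chainCost t n f := by
  unfold chainCost
  rw [← Finset.sum_range_reflect]
  refine Finset.sum_congr rfl fun k hk => ?_
  have hk := Finset.mem_range.1 hk
  dsimp only
  rw [show n - (n - 1 - k) = k + 1 by omega, show n - (n - 1 - k + 1) = k by omega]
  exact (hFun_comm t (h.2.2.2 k hk)).symm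

theorem IsAdmissibleChain.append {x y z : X} {n m : ℕ} {f g : ℕ → X}
    (hf : P.IsAdmissibleChain x y n f) (hg : P.IsAdmissibleChain y z m g) :
    P.IsAdmissibleChain x z (n + m) (fun k => if k ≤ n then f k else g (k - n)) := by
  obtain ⟨f0, fn, fmem, flink⟩ := hf
  obtain ⟨g0, gm, gmem, glink⟩ := hg
  refine ⟨by simpa using f0, ?_, fun k hk => ?_, fun k hk => ?_⟩
  · rcases Nat.eq_zero_or_pos m with rfl | hm
    · simp [fn, ← gm, g0]
    · simp [hm.ne', gm]
  · dsimp only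
    split_ifs with h
    · exact fmem k h
    · exact gmem _ (by omega)
  · dsimp only
    rcases lt_trichotomy k n with h | rfl | h
    · rw [if_pos h.le, if_pos (by omega)]
      exact flink k h
    · have := glink 0 (by omega)
      simpa [fn, g0] using this
    · rw [if_neg (by omega), if_neg (by omega), show k + 1 - n = k - n + 1 by omega]
      exact glink _ (by omega)

theorem chainCost_append (t : ℝ) {n : ℕ} (m : ℕ) {f g : ℕ → X} (h : f n = g 0) :
    P.chainCost t (n + m) (fun k => if k ≤ n then f k else g (k - n)) =
      P.chainCost t n f + P.chainCost t m g := by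
  unfold chainCost
  rw [Finset.sum_range_add]
  congr 1
  · refine Finset.sum_congr rfl fun k hk => ?_
    have hk := Finset.mem_range.1 hk
    dsimp only
    rw [if_pos hk.le, if_pos (by omega)]
  · refine Finset.sum_congr rfl fun k _ => ?_
    dsimp only
    rw [if_neg (show ¬n + k + 1 ≤ n by omega), show n + k + 1 - n = k + 1 by omega]
    rcases Nat.eq_zero_or_pos k with rfl | hk
    · simp [h]
    · rw [if_neg (by omega), Nat.add_sub_cancel_left]

theorem KM_le_chainCost {t : ℝ} (ht : 0 < t) {x y : X} {n : ℕ} {f : ℕ → X}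
    (h : P.IsAdmissibleChain x y n f) : P.KM t x y ≤ P.chainCost t n f := by
  refine csInf_le ⟨0, ?_⟩ ⟨n, f, h, rfl⟩
  rintro _ ⟨n, f, hf, rfl⟩
  exact chainCost_nonneg ht hf

theorem isAdmissibleChain_single {x y : X} (h : P.Linked x y) :
    P.IsAdmissibleChain x y 1 (fun k => if k = 0 then x else y) := by
  refine ⟨by simp, by simp, fun k _ => ?_, fun k hk => ?_⟩
  · unfold Linked at h
    simp only [Set.mem_union]
    grind
  · obtain rfl : k = 0 := by omega
    simpa [Linked] using h

theorem le_KM {t a : ℝ} {x y : X} (hx : x ∈ P.X0 ∩ P.X1) (hy : y ∈ P.X0 ∩ P.X1)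
    (h : ∀ n f, P.IsAdmissibleChain x y n f → a ≤ P.chainCost t n f) : a ≤ P.KM t x y := by
  refine le_csInf ⟨_, 1, _, isAdmissibleChain_single (.inl ⟨hx.1, hy.1⟩), rfl⟩ ?_
  rintro _ ⟨n, f, hf, rfl⟩
  exact h n f hf

theorem mul_dist_le_KM {t : ℝ} (ht : 0 < t) {x y : X} (hx : x ∈ P.X0 ∩ P.X1)
    (hy : y ∈ P.X0 ∩ P.X1) : min P.C0⁻¹ (t * P.C1⁻¹) * dist x y ≤ P.KM t x y :=
  le_KM hx hy fun _ _ => mul_dist_le_chainCost ht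

theorem KM_nonneg {t : ℝ} (ht : 0 < t) {x y : X} (hx : x ∈ P.X0 ∩ P.X1)
    (hy : y ∈ P.X0 ∩ P.X1) : 0 ≤ P.KM t x y :=
  le_KM hx hy fun _ _ => chainCost_nonneg ht

theorem KM_le_min {t : ℝ} (ht : 0 < t) {x y : X} (hx : x ∈ P.X0 ∩ P.X1)
    (hy : y ∈ P.X0 ∩ P.X1) : P.KM t x y ≤ min (P.d0 x y) (t * P.d1 x y) := by
  refine (KM_le_chainCost ht (isAdmissibleChain_single (.inl ⟨hx.1, hy.1⟩))).trans_eq ?_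
  simp [chainCost, hFun, hx.1, hx.2, hy.1, hy.2]

theorem KM_self {t : ℝ} (ht : 0 < t) {x : X} (hx : x ∈ P.X0 ∩ P.X1) : P.KM t x x = 0 := by
  refine le_antisymm ((KM_le_min ht hx hx).trans ?_) (KM_nonneg ht hx hx)
  exact (min_le_left _ _).trans (P.met0.refl x hx.1).le

theorem KM_comm {t : ℝ} (ht : 0 < t) {x y : X} (hx : x ∈ P.X0 ∩ P.X1)
    (hy : y ∈ P.X0 ∩ P.X1) : P.KM t x y = P.KM t y x :=
  le_antisymm
    (le_KM hy hx fun _ _ h => (KM_le_chainCost ht h.reverse).trans_eq (h.chainCost_reverse t))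
    (le_KM hx hy fun _ _ h => (KM_le_chainCost ht h.reverse).trans_eq (h.chainCost_reverse t))

theorem KM_triangle {t : ℝ} (ht : 0 < t) {x y z : X} (hx : x ∈ P.X0 ∩ P.X1)
    (hy : y ∈ P.X0 ∩ P.X1) (hz : z ∈ P.X0 ∩ P.X1) :
    P.KM t x z ≤ P.KM t x y + P.KM t y z := by
  rw [← sub_le_iff_le_add]
  refine le_KM hx hy fun n f hf => ?_
  rw [sub_le_iff_le_add, ← sub_le_iff_le_add']
  refine le_KM hy hz fun m g hg => ?_
  rw [sub_le_iff_le_add']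
  exact (KM_le_chainCost ht (hf.append hg)).trans_eq
    (chainCost_append t m (hf.2.1.trans hg.1.symm))

theorem summable_weighted_KM {θ : ℝ} (hθ : θ ∈ Set.Ioo (0 : ℝ) 1) {x y : X}
    (hx : x ∈ P.X0 ∩ P.X1) (hy : y ∈ P.X0 ∩ P.X1) :
    Summable fun k : ℤ => (2 : ℝ) ^ (-(k : ℝ) * θ) * P.KM ((2 : ℝ) ^ k) x y := by
  have hpos (k : ℤ) : (0 : ℝ) < 2 ^ k := by positivity
  have hnonneg (k : ℤ) : 0 ≤ (2 : ℝ) ^ (-(k : ℝ) * θ) * P.KM ((2 : ℝ) ^ k) x y :=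
    mul_nonneg (by positivity) (KM_nonneg (hpos k) hx hy)
  have hgeom {s : ℝ} (hs : s < 0) (d : ℝ) : Summable fun n : ℕ => ((2 : ℝ) ^ s) ^ n * d :=
    (summable_geometric_of_lt_one (by positivity)
      (Real.rpow_lt_one_of_one_lt_of_neg one_lt_two hs)).mul_right d
  refine Summable.of_nat_of_neg
    (.of_nonneg_of_le (fun n => hnonneg _) (fun n => ?_) (hgeom (neg_lt_zero.2 hθ.1) (P.d0 x y)))
    (.of_nonneg_of_le (fun n => hnonneg _) (fun n => ?_) (hgeom (sub_neg.2 hθ.2) (P.d1 x y)))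
  · rw [← Real.rpow_mul_natCast zero_le_two, Int.cast_natCast,
      show -θ * (n : ℝ) = -(n : ℝ) * θ by ring]
    gcongr
    exact (KM_le_min (hpos _) hx hy).trans (min_le_left _ _)
  · calc (2 : ℝ) ^ (-((-(n : ℤ) : ℤ) : ℝ) * θ) * P.KM ((2 : ℝ) ^ (-(n : ℤ))) x y
        ≤ (2 : ℝ) ^ (-((-(n : ℤ) : ℤ) : ℝ) * θ) * ((2 : ℝ) ^ (-(n : ℤ)) * P.d1 x y) := by
          gcongr
          exact (KM_le_min (hpos _) hx hy).trans (min_le_right _ _)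
      _ = ((2 : ℝ) ^ (θ - 1)) ^ n * P.d1 x y := by
          rw [← mul_assoc, ← Real.rpow_intCast, ← Real.rpow_add two_pos,
            ← Real.rpow_mul_natCast zero_le_two]
          congr 2
          push_cast
          ring

end CompatiblePair

open MeasureTheory

theorem GammaE_eq_eLpNorm (θ : ℝ) {q : ℝ≥0∞} (hq : q ≠ 0) (x : ℤ → ℝ) :
    GammaE θ q x = eLpNorm (fun k : ℤ => (2 : ℝ) ^ (-(k : ℝ) * θ) * x k) q .count := by
  have henorm (k : ℤ) : ENNReal.ofReal ((2 : ℝ) ^ (-(k : ℝ) * θ) * |x k|) =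
      ‖(2 : ℝ) ^ (-(k : ℝ) * θ) * x k‖ₑ := by
    rw [Real.enorm_eq_ofReal_abs, abs_mul, abs_of_pos (Real.rpow_pos_of_pos two_pos _)]
  unfold GammaE
  simp_rw [henorm]
  split_ifs with h
  · rw [h, eLpNorm_exponent_top, eLpNormEssSup_count]
  · rw [eLpNorm_eq_lintegral_rpow_enorm_toReal hq h, lintegral_count]

/-- A summable sequence lies in `ℓ^q` for every `q ≥ 1`. -/
theorem eLpNorm_count_ne_top_of_summable {α : Type*} [MeasurableSpace α]
    [MeasurableSingletonClass α] {f : α → ℝ} (hf : Summable f) {q : ℝ≥0∞} (hq : 1 ≤ q) :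
    eLpNorm f q .count ≠ ∞ := by
  have hsum : ∑' a, ‖f a‖ₑ ≠ ∞ := by
    simp_rw [Real.enorm_eq_ofReal_abs]
    exact hf.abs.tsum_ofReal_ne_top
  have hle (a : α) : ‖f a‖ₑ ≤ ∑' a, ‖f a‖ₑ := ENNReal.le_tsum a
  by_cases h : q = ∞
  · rw [h, eLpNorm_exponent_top, eLpNormEssSup_count]
    exact ne_top_of_le_ne_top hsum (iSup_le hle)
  · have hq1 : 1 ≤ q.toReal := by
      simpa using ENNReal.toReal_mono h hq
    rw [eLpNorm_eq_lintegral_rpow_enorm_toReal (one_pos.trans_le hq).ne' h, lintegral_count]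
    refine ENNReal.rpow_ne_top_of_nonneg (by positivity) ?_
    have hpow (a : α) : ‖f a‖ₑ ^ q.toReal ≤ ‖f a‖ₑ * (∑' a, ‖f a‖ₑ) ^ (q.toReal - 1) := by
      calc ‖f a‖ₑ ^ q.toReal = ‖f a‖ₑ ^ (1 + (q.toReal - 1)) := by rw [add_sub_cancel]
        _ = ‖f a‖ₑ * ‖f a‖ₑ ^ (q.toReal - 1) := by
            rw [ENNReal.rpow_add_of_nonneg _ _ zero_le_one (sub_nonneg.2 hq1), ENNReal.rpow_one]
        _ ≤ _ := by
            gcongr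
            exact hle a
    refine ne_top_of_le_ne_top ?_ (ENNReal.tsum_le_tsum hpow)
    rw [ENNReal.tsum_mul_right]
    exact ENNReal.mul_ne_top hsum (ENNReal.rpow_ne_top_of_nonneg (sub_nonneg.2 hq1) hsum)

/-- `β_{θ,q}` is a metric on `X₀ ∩ X₁`. -/
theorem beta_isMetricOn {X : Type*} [MetricSpace X] (P : CompatiblePair X)
    (θ : ℝ) (hθ : θ ∈ Set.Ioo (0 : ℝ) 1) (q : ℝ≥0∞) (hq : 1 ≤ q) :
    IsMetricOn (P.beta θ q) (P.X0 ∩ P.X1) := by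
  have hq0 : q ≠ 0 := (one_pos.trans_le hq).ne'
  have hpos (k : ℤ) : (0 : ℝ) < 2 ^ k := by positivity
  set w : X → X → ℤ → ℝ :=
    fun x y k => (2 : ℝ) ^ (-(k : ℝ) * θ) * P.KM ((2 : ℝ) ^ k) x y with hw
  have hbeta (x y : X) : P.beta θ q x y = (eLpNorm (w x y) q .count).toReal := by
    rw [CompatiblePair.beta, Gamma, GammaE_eq_eLpNorm θ hq0]
  have hfin {x y : X} (hx : x ∈ P.X0 ∩ P.X1) (hy : y ∈ P.X0 ∩ P.X1) :
      eLpNorm (w x y) q .count ≠ ∞ :=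
    eLpNorm_count_ne_top_of_summable (CompatiblePair.summable_weighted_KM hθ hx hy) hq
  have hmeas (f : ℤ → ℝ) : AEStronglyMeasurable f .count :=
    StronglyMeasurable.of_discrete.aestronglyMeasurable
  constructor
  · intro x hx
    have : w x x = 0 := by
      funext k
      simp [hw, CompatiblePair.KM_self (hpos k) hx]
    simp [hbeta, this]
  · intro x hx y hy h
    rw [hbeta, ENNReal.toReal_eq_zero_iff, or_iff_left (hfin hx hy),
      eLpNorm_eq_zero_iff (hmeas _) hq0, Filter.EventuallyEq, Measure.ae_count_iff] at h
    have hK : P.KM 1 x y = 0 := by simpa [hw] using h 0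
    have hle := CompatiblePair.mul_dist_le_KM one_pos hx hy
    rw [hK] at hle
    exact dist_le_zero.1 (nonpos_of_mul_nonpos_right hle (P.min_inv_pos one_pos))
  · intro x hx y hy
    have : w x y = w y x := by
      funext k
      simp only [hw, CompatiblePair.KM_comm (hpos k) hx hy]
    rw [hbeta, hbeta, this]
  · intro x hx y hy z hz
    rw [hbeta, hbeta, hbeta, ← ENNReal.toReal_add (hfin hx hy) (hfin hy hz)]
    refine ENNReal.toReal_mono (ENNReal.add_ne_top.2 ⟨hfin hx hy, hfin hy hz⟩) ?_
    refine le_trans (eLpNorm_mono_real fun k => ?_) (eLpNorm_add_le (hmeas _) (hmeas _) hq)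
    have hnonneg : 0 ≤ w x z k :=
      mul_nonneg (by positivity) (CompatiblePair.KM_nonneg (hpos k) hx hz)
    rw [Real.norm_of_nonneg hnonneg, Pi.add_apply]
    simp only [hw, ← mul_add]
    gcongr
    exact CompatiblePair.KM_triangle (hpos k) hx hy hz
end

section
/- Let (X₀, X₁)_X be a pair of compatible metric spaces with X₀ ∩ X₁ ≠ ∅, let θ ∈ (0, 1) and q ∈ [1, ∞]. The functional p_{θ,q} is a separator on X₀ ∩ X₁: it takes finite nonnegative values, and p_{θ,q}(x, y) = 0 if and only if x = y. -/
open scoped ENNReal Classical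

/-- A weighted term of a sequence is bounded by its `Γ_{θ,q}` value. -/
lemma ofReal_weighted_le_GammaE (θ : ℝ) {q : ℝ≥0∞} (hq : q ≠ 0) (x : ℤ → ℝ) (k : ℤ) :
    ENNReal.ofReal ((2 : ℝ) ^ (-(k : ℝ) * θ) * |x k|) ≤ GammaE θ q x := by
  unfold GammaE
  split_ifs with h
  · exact le_iSup (fun k : ℤ => ENNReal.ofReal ((2 : ℝ) ^ (-(k : ℝ) * θ) * |x k|)) k
  · have hpos : 0 < q.toReal := ENNReal.toReal_pos hq h
    rw [one_div, ENNReal.le_rpow_inv_iff hpos]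
    exact ENNReal.le_tsum
      (f := fun k : ℤ => ENNReal.ofReal ((2 : ℝ) ^ (-(k : ℝ) * θ) * |x k|) ^ q.toReal) k

/-- `Γ_{θ,q}` vanishes on the zero sequence. -/
lemma GammaE_zero (θ : ℝ) {q : ℝ≥0∞} (hq : q ≠ 0) : GammaE θ q (fun _ => 0) = 0 := by
  unfold GammaE
  split_ifs with h
  · simp
  · have hpos : 0 < q.toReal := ENNReal.toReal_pos hq h
    simp [ENNReal.zero_rpow_of_pos hpos, hpos]

/-- `Γ_{θ,q}` is finite on sequences with at most one nonzero term. -/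
lemma GammaE_ne_top_of_eq_zero_of_ne (θ : ℝ) {q : ℝ≥0∞} (hq : q ≠ 0) (x : ℤ → ℝ) (k₀ : ℤ)
    (hx : ∀ k, k ≠ k₀ → x k = 0) : GammaE θ q x ≠ ⊤ := by
  unfold GammaE
  split_ifs with h
  · refine ne_top_of_le_ne_top
      (ENNReal.ofReal_ne_top (r := (2 : ℝ) ^ (-(k₀ : ℝ) * θ) * |x k₀|)) (iSup_le fun k => ?_)
    by_cases hk : k = k₀
    · rw [hk]
    · simp [hx k hk]
  · have hpos : 0 < q.toReal := ENNReal.toReal_pos hq h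
    rw [tsum_eq_single k₀ fun k hk => by simp [hx k hk, ENNReal.zero_rpow_of_pos hpos]]
    exact ENNReal.rpow_ne_top_of_nonneg (by positivity)
      (ENNReal.rpow_ne_top_of_nonneg hpos.le ENNReal.ofReal_ne_top)

namespace CompatiblePair

variable {X : Type*} [MetricSpace X] (P : CompatiblePair X)

lemma d0_nonneg {x y : X} (hx : x ∈ P.X0) (hy : y ∈ P.X0) : 0 ≤ P.d0 x y :=
  nonneg_of_mul_nonneg_right (dist_nonneg.trans (P.compat0 x hx y hy)) P.C0_pos

lemma d1_nonneg {x y : X} (hx : x ∈ P.X1) (hy : y ∈ P.X1) : 0 ≤ P.d1 x y :=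
  nonneg_of_mul_nonneg_right (dist_nonneg.trans (P.compat1 x hx y hy)) P.C1_pos

/-- The ambient distance is controlled by the cost `h_1`. -/
lemma dist_le_hFun {x y : X} (h : (x ∈ P.X0 ∧ y ∈ P.X0) ∨ (x ∈ P.X1 ∧ y ∈ P.X1)) :
    dist x y ≤ max P.C0 P.C1 * P.hFun 1 x y := by
  have h0 (hx : x ∈ P.X0) (hy : y ∈ P.X0) : dist x y ≤ max P.C0 P.C1 * P.d0 x y :=
    (P.compat0 x hx y hy).trans
      (mul_le_mul_of_nonneg_right (le_max_left _ _) (P.d0_nonneg hx hy))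
  have h1 (hx : x ∈ P.X1) (hy : y ∈ P.X1) : dist x y ≤ max P.C0 P.C1 * P.d1 x y :=
    (P.compat1 x hx y hy).trans
      (mul_le_mul_of_nonneg_right (le_max_right _ _) (P.d1_nonneg hx hy))
  unfold hFun
  rw [one_mul]
  split_ifs with hI hX0
  · rcases min_choice (P.d0 x y) (P.d1 x y) with hm | hm <;> rw [hm]
    · exact h0 hI.1.1 hI.2.1
    · exact h1 hI.1.2 hI.2.2
  · exact h0 hX0.1 hX0.2
  · have hX1 := h.resolve_left hX0
    exact h1 hX1.1 hX1.2

/-- The ambient distance is controlled by the cost of any admissible chain. -/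
lemma dist_le_chain_sum {x y : X} {n : ℕ} {f : ℕ → X} (h : P.IsAdmissibleChain x y n f) :
    dist x y ≤ max P.C0 P.C1 * ∑ k ∈ Finset.range n, P.hFun 1 (f k) (f (k + 1)) := by
  obtain ⟨rfl, rfl, -, hlink⟩ := h
  rw [Finset.mul_sum]
  exact (dist_le_range_sum_dist f n).trans
    (Finset.sum_le_sum fun k hk => P.dist_le_hFun (hlink k (Finset.mem_range.1 hk)))

lemma max_C_pos : 0 < max P.C0 P.C1 := lt_max_of_lt_left P.C0_pos

/-- The ambient distance is controlled by `K_M(1)` on `X₀ ∩ X₁`. -/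
lemma dist_le_KM {x y : X} (hx : x ∈ P.X0 ∩ P.X1) (hy : y ∈ P.X0 ∩ P.X1) :
    dist x y ≤ max P.C0 P.C1 * P.KM 1 x y := by
  rw [← div_le_iff₀' P.max_C_pos]
  refine le_csInf ⟨_, 1, fun k => if k = 0 then x else y, ?_, rfl⟩ ?_
  · refine ⟨by simp, by simp, fun k _ => ?_, fun k hk => ?_⟩
    · dsimp only
      split_ifs
      exacts [Or.inl hx.1, Or.inl hy.1]
    · obtain rfl : k = 0 := by lia
      exact Or.inl ⟨by simpa using hx.1, by simpa using hy.1⟩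
  · rintro s ⟨n, f, hf, rfl⟩
    rw [div_le_iff₀' P.max_C_pos]
    exact P.dist_le_chain_sum hf

lemma KM_one_self {x : X} (hx : x ∈ P.X0 ∪ P.X1) : P.KM 1 x x = 0 := by
  refine IsLeast.csInf_eq ⟨⟨0, fun _ => x, ⟨rfl, rfl, fun _ _ => hx, by simp⟩, by simp⟩, ?_⟩
  rintro s ⟨n, f, hf, rfl⟩
  exact nonneg_of_mul_nonneg_right (dist_nonneg.trans (P.dist_le_chain_sum hf)) P.max_C_pos

lemma JM_self (t : ℝ) {x : X} (hx : x ∈ P.X0 ∩ P.X1) : P.JM t x x = 0 := by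
  simp [JM, P.met0.refl x hx.1, P.met1.refl x hx.2]

lemma isApproxSeq_const {x : X} (hx : x ∈ P.X0 ∩ P.X1) : P.IsApproxSeq x (fun _ => x) := by
  refine ⟨fun _ => hx, fun ε hε => ⟨0, fun _ _ _ _ => ?_⟩, ?_⟩
  · rwa [P.JM_self 1 hx]
  · simp [P.KM_one_self (Or.inl hx.1)]

/-- Approximating sequences converge in the ambient space. -/
lemma IsApproxSeq.tendsto {P : CompatiblePair X} {x : X} {u : ℕ → X} (hu : P.IsApproxSeq x u)
    (hx : x ∈ P.X0 ∩ P.X1) : Filter.Tendsto u Filter.atTop (nhds x) := by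
  rw [tendsto_iff_dist_tendsto_zero]
  refine squeeze_zero (fun _ => dist_nonneg) (fun n => P.dist_le_KM (hu.1 n) hx) ?_
  simpa using hu.2.2.const_mul (max P.C0 P.C1)

lemma pFunE_le (θ : ℝ) (q : ℝ≥0∞) {x y : X} {u v : ℕ → X} (hu : P.IsApproxSeq x u)
    (hv : P.IsApproxSeq y v) :
    P.pFunE θ q x y ≤ GammaE θ q (fun k : ℤ =>
      P.JM ((2 : ℝ) ^ k) (linkSeq u v k) (linkSeq u v (k + 1))) :=
  iInf_le_of_le u <| iInf_le_of_le v <| iInf_le_of_le hu <| iInf_le_of_le hv le_rfl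

lemma pFunE_ne_top (θ : ℝ) {q : ℝ≥0∞} (hq : q ≠ 0) {x y : X} (hx : x ∈ P.X0 ∩ P.X1)
    (hy : y ∈ P.X0 ∩ P.X1) : P.pFunE θ q x y ≠ ⊤ := by
  refine ne_top_of_le_ne_top ?_ (P.pFunE_le θ q (P.isApproxSeq_const hx) (P.isApproxSeq_const hy))
  refine GammaE_ne_top_of_eq_zero_of_ne θ hq _ (-1) fun k hk => ?_
  rcases lt_or_ge k 0 with h | h
  · simp [linkSeq, not_le.2 h, show ¬ 0 ≤ k + 1 by lia, P.JM_self _ hy]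
  · simp [linkSeq, h, show 0 ≤ k + 1 by lia, P.JM_self _ hx]

lemma pFunE_self (θ : ℝ) {q : ℝ≥0∞} (hq : q ≠ 0) {x : X} (hx : x ∈ P.X0 ∩ P.X1) :
    P.pFunE θ q x x = 0 := by
  have h := P.pFunE_le θ q (P.isApproxSeq_const hx) (P.isApproxSeq_const hx)
  simp only [linkSeq, ite_self, P.JM_self _ hx, GammaE_zero θ hq] at h
  exact le_antisymm h zero_le

lemma linkSeq_mem {Y : Type*} {u v : ℕ → Y} {A : Set Y} (hu : ∀ n, u n ∈ A) (hv : ∀ n, v n ∈ A) (k : ℤ) :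
    linkSeq u v k ∈ A := by
  unfold linkSeq
  split_ifs
  exacts [hu _, hv _]

/-- The ambient distance between the limits of two approximating sequences is controlled by any
strict bound for the `Γ_{θ,q}` value of the linking sequence. -/
lemma dist_le_of_GammaE_lt {θ : ℝ} (hθ : θ ∈ Set.Ioo (0 : ℝ) 1) {q : ℝ≥0∞} (hq : q ≠ 0)
    {x y : X} (hx : x ∈ P.X0 ∩ P.X1) (hy : y ∈ P.X0 ∩ P.X1) {u v : ℕ → X}
    (hu : P.IsApproxSeq x u) (hv : P.IsApproxSeq y v) {ε : ℝ} (hε : 0 < ε)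
    (h : GammaE θ q (fun k : ℤ =>
      P.JM ((2 : ℝ) ^ k) (linkSeq u v k) (linkSeq u v (k + 1))) < ENNReal.ofReal ε) :
    dist x y ≤ (P.C1 / (1 - (2 : ℝ) ^ (θ - 1)) + P.C0 / (1 - (2 : ℝ) ^ (-θ))) * ε := by
  set S := linkSeq u v with hS
  have hmem : ∀ k, S k ∈ P.X0 ∩ P.X1 := linkSeq_mem hu.1 hv.1
  have hterm (k : ℤ) : P.JM ((2 : ℝ) ^ k) (S k) (S (k + 1)) ≤ ε * (2 : ℝ) ^ ((k : ℝ) * θ) := by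
    have h1 := ((ofReal_weighted_le_GammaE θ hq _ k).trans_lt h).le
    rw [ENNReal.ofReal_le_ofReal_iff hε.le, neg_mul, Real.rpow_neg zero_le_two,
      inv_mul_le_iff₀ (by positivity)] at h1
    rw [mul_comm]
    exact (le_abs_self _).trans h1
  have hd0 (k : ℤ) : dist (S k) (S (k + 1)) ≤ P.C0 * ε * (2 : ℝ) ^ ((k : ℝ) * θ) := by
    rw [mul_assoc]
    exact (P.compat0 _ (hmem k).1 _ (hmem (k + 1)).1).trans
      (mul_le_mul_of_nonneg_left ((le_max_left _ _).trans (hterm k)) P.C0_pos.le)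
  have hd1 (k : ℤ) : dist (S k) (S (k + 1)) ≤ P.C1 * ε * (2 : ℝ) ^ ((k : ℝ) * (θ - 1)) := by
    have h1 : (2 : ℝ) ^ k * P.d1 (S k) (S (k + 1)) ≤ ε * (2 : ℝ) ^ ((k : ℝ) * θ) :=
      (le_max_right _ _).trans (hterm k)
    rw [← le_div_iff₀' (by positivity), mul_div_assoc, ← Real.rpow_intCast,
      ← Real.rpow_sub zero_lt_two, ← mul_sub_one] at h1
    rw [mul_assoc]
    exact (P.compat1 _ (hmem k).2 _ (hmem (k + 1)).2).trans
      (mul_le_mul_of_nonneg_left h1 P.C1_pos.le)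
  have hr1 : (2 : ℝ) ^ (θ - 1) < 1 :=
    Real.rpow_lt_one_of_one_lt_of_neg one_lt_two (sub_neg.2 hθ.2)
  have hr0 : (2 : ℝ) ^ (-θ) < 1 :=
    Real.rpow_lt_one_of_one_lt_of_neg one_lt_two (neg_neg_of_pos hθ.1)
  have hxdist : dist (u 0) x ≤ P.C1 * ε / (1 - (2 : ℝ) ^ (θ - 1)) := by
    refine dist_le_of_le_geometric_of_tendsto₀ _ _ hr1 (fun n => ?_) (hu.tendsto hx)
    have h1 := hd1 n
    have hSn : S n = u n := by simp [hS, linkSeq]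
    have hSn' : S ((n : ℤ) + 1) = u (n + 1) := by simp [hS, linkSeq, show (0 : ℤ) ≤ n + 1 by lia]
    rwa [hSn, hSn', mul_comm (((n : ℤ) : ℝ)), Int.cast_natCast, Real.rpow_mul zero_le_two,
      Real.rpow_natCast] at h1
  have hydist : dist (u 0) y ≤ P.C0 * ε / (1 - (2 : ℝ) ^ (-θ)) := by
    have hlim : Filter.Tendsto (fun n : ℕ => S (-(n : ℤ))) Filter.atTop (nhds y) := by
      refine (hv.tendsto hy).congr' ?_
      filter_upwards [Filter.eventually_gt_atTop 0] with n hn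
      simp [hS, linkSeq, hn.ne']
    have hS0 : S (-((0 : ℕ) : ℤ)) = u 0 := by simp [hS, linkSeq]
    rw [← hS0]
    refine dist_le_of_le_geometric_of_tendsto₀ (f := fun n : ℕ => S (-(n : ℤ))) _ _ hr0
      (fun n => ?_) hlim
    have h1 := hd0 (-((n + 1 : ℕ) : ℤ))
    rw [show -((n + 1 : ℕ) : ℤ) + 1 = -(n : ℤ) by push_cast; ring, dist_comm] at h1
    refine h1.trans (mul_le_mul_of_nonneg_left ?_ (mul_nonneg P.C0_pos.le hε.le))
    rw [← Real.rpow_natCast, ← Real.rpow_mul zero_le_two]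
    refine Real.rpow_le_rpow_of_exponent_le one_le_two ?_
    push_cast
    nlinarith [hθ.1]
  calc dist x y ≤ dist (u 0) x + dist (u 0) y := dist_triangle_left x y (u 0)
    _ ≤ _ := add_le_add hxdist hydist
    _ = _ := by ring

lemma eq_of_pFunE_eq_zero {θ : ℝ} (hθ : θ ∈ Set.Ioo (0 : ℝ) 1) {q : ℝ≥0∞} (hq : q ≠ 0)
    {x y : X} (hx : x ∈ P.X0 ∩ P.X1) (hy : y ∈ P.X0 ∩ P.X1) (h : P.pFunE θ q x y = 0) :
    x = y := by
  set M := P.C1 / (1 - (2 : ℝ) ^ (θ - 1)) + P.C0 / (1 - (2 : ℝ) ^ (-θ))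
  have hbound (ε : ℝ) (hε : 0 < ε) : dist x y ≤ M * ε := by
    have hlt : P.pFunE θ q x y < ENNReal.ofReal ε := by
      rw [h]
      exact ENNReal.ofReal_pos.2 hε
    simp only [pFunE, iInf_lt_iff] at hlt
    obtain ⟨u, v, hu, hv, hG⟩ := hlt
    exact P.dist_le_of_GammaE_lt hθ hq hx hy hu hv hε hG
  have hlim : Filter.Tendsto (fun ε : ℝ => M * ε) (nhdsWithin 0 (Set.Ioi 0)) (nhds 0) := by
    have hcont : Continuous fun ε : ℝ => M * ε := by fun_prop
    simpa using (hcont.tendsto 0).mono_left nhdsWithin_le_nhds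
  refine dist_le_zero.1 (ge_of_tendsto hlim ?_)
  filter_upwards [self_mem_nhdsWithin] with ε hε using hbound ε hε

end CompatiblePair

/-- `p_{θ,q}` is a separator on `X₀ ∩ X₁`: it takes finite nonnegative
values, and it vanishes exactly on the diagonal. -/
theorem pFun_isSeparator {X : Type*} [MetricSpace X] (P : CompatiblePair X)
    (θ : ℝ) (hθ : θ ∈ Set.Ioo (0 : ℝ) 1) (q : ℝ≥0∞) (hq : 1 ≤ q) :
    ∀ x ∈ P.X0 ∩ P.X1, ∀ y ∈ P.X0 ∩ P.X1,
      P.pFunE θ q x y ≠ ⊤ ∧ 0 ≤ P.pFun θ q x y ∧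
        (P.pFun θ q x y = 0 ↔ x = y) := by
  intro x hx y hy
  have hq0 : q ≠ 0 := (zero_lt_one.trans_le hq).ne'
  have htop := P.pFunE_ne_top θ hq0 hx hy
  refine ⟨htop, ENNReal.toReal_nonneg, fun h => ?_, ?_⟩
  · exact P.eq_of_pFunE_eq_zero hθ hq0 hx hy
      (((ENNReal.toReal_eq_zero_iff _).1 h).resolve_right htop)
  · rintro rfl
    simp [CompatiblePair.pFun, P.pFunE_self θ hq0 hx]
end
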